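/- Let z = x + iy with x > 1 and y > 0. Then Im( z / (z² − 1)^{1/2} ) < 0, where w^{1/2} = exp((1/2)·Log w) is the principal complex square root. (Note z² − 1 has positive imaginary part 2xy, so it avoids the branch cut.) -/

import Mathlib

open Complex in
/-- The principal square root of a complex number has positive real part off the branch cut. -/
theorem re_exp_half_log_pos {w : ℂ} (hw : w ∈ slitPlane) :
    0 < (exp ((1 / 2) * log w)).re := by
  have him : ((1 / 2 : ℂ) * log w).im = arg w / 2 := by
    rw [show (1 / 2 : ℂ) = ((1 / 2 : ℝ) : ℂ) by push_cast; rfl, im_ofReal_mul, log_im]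
    ring
  rw [exp_re, him]
  have hlt : arg w < Real.pi := lt_of_le_of_ne (arg_le_pi w) (slitPlane_arg_ne_pi hw)
  have hgt := neg_pi_lt_arg w
  exact mul_pos (Real.exp_pos _) (Real.cos_pos_of_mem_Ioo ⟨by linarith, by linarith⟩)

open Complex in
theorem exp_half_log_sq {w : ℂ} (hw : w ≠ 0) : exp ((1 / 2) * log w) ^ 2 = w := by
  rw [← exp_nat_mul, ← mul_assoc]
  norm_num [exp_log hw]

open Complex in
/-- For `z = x + iy` with `x > 1`, `y > 0`, one has `Im(z/(z²−1)^{1/2}) < 0`,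
where `w^{1/2} = exp((1/2)·Log w)` is the principal complex square root. -/
theorem stmt_7 (x y : ℝ) (hx : 1 < x) (hy : 0 < y) :
    (((x : ℂ) + y * I) /
        Complex.exp ((1 / 2) * Complex.log (((x : ℂ) + y * I) ^ 2 - 1))).im < 0 := by
  have hx0 : 0 < x := one_pos.trans hx
  have hw_re : (((x : ℂ) + y * I) ^ 2 - 1).re = x ^ 2 - y ^ 2 - 1 := by
    simp [pow_two]
  have hw_im : (((x : ℂ) + y * I) ^ 2 - 1).im = 2 * (x * y) := by
    simp [pow_two]
    ring
  have hw : ((x : ℂ) + y * I) ^ 2 - 1 ∈ slitPlane := by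
    refine mem_slitPlane_iff.2 (Or.inr ?_)
    rw [hw_im]
    positivity
  have ha := re_exp_half_log_pos hw
  have hsq := exp_half_log_sq (slitPlane_ne_zero hw)
  rw [Complex.ext_iff, hw_re, hw_im] at hsq
  generalize exp ((1 / 2) * log (((x : ℂ) + y * I) ^ 2 - 1)) = s at ha hsq ⊢
  obtain ⟨a, b⟩ := s
  simp only [pow_two, mul_re, mul_im] at ha hsq
  obtain ⟨hre, him⟩ := hsq
  have hab : a * b = x * y := by linarith
  have hb : 0 < b := pos_of_mul_pos_right (hab ▸ mul_pos hx0 hy) ha.le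
  have key : y * a < x * b := by
    by_contra! h
    have hxa : x * x ≤ a * a := by
      refine le_of_mul_le_mul_left ?_ hy
      calc y * (x * x) = x * b * a := by linear_combination -x * hab
        _ ≤ y * a * a := mul_le_mul_of_nonneg_right h ha.le
        _ = y * (a * a) := by ring
    have hby : b * b ≤ y * y := by
      refine le_of_mul_le_mul_left ?_ hx0
      calc x * (b * b) = x * b * b := by ring
        _ ≤ y * a * b := mul_le_mul_of_nonneg_right h hb.le
        _ = x * (y * y) := by linear_combination y * hab
    linarith
  have hdiv : (((x : ℂ) + y * I) / ⟨a, b⟩).im = (y * a - x * b) / (a * a + b * b) := by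
    simp [div_im, normSq_mk, sub_div]
  rw [hdiv]
  exact div_neg_of_neg_of_pos (by linarith) (by positivity)
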